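/- Let P ∈ ℂ[x₁,…,xₙ] and let Λ be an n×n matrix with entries in the Laurent polynomial ring ℂ[t,t⁻¹] satisfying ΛᵀΛ = I (identity matrix over ℂ[t,t⁻¹]). Suppose that the polynomial P(Λx), obtained from P by substituting xᵢ ↦ Σⱼ Λᵢⱼ xⱼ and regarded as a polynomial in x₁,…,xₙ with coefficients in ℂ[t,t⁻¹], has all its coefficients lying in t·ℂ[t] (i.e., each coefficient is an ordinary polynomial in t with zero constant term and no negative powers of t). Then for every Q ∈ ℂ[x₁,…,xₙ], E(Q·Pᵐ) = 0 for all sufficiently large m, where E denotes the Gaussian expectation with respect to γₙ. -/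

import Mathlib

open MeasureTheory ProbabilityTheory

/-- The Gaussian expectation of a complex polynomial in the variables indexed by `σ`,
with respect to the standard Gaussian measure (product of `N(0,1)`'s). -/
noncomputable def gaussExp {σ : Type*} [Fintype σ] (P : MvPolynomial σ ℂ) : ℂ :=
  ∫ x : σ → ℝ, MvPolynomial.eval (fun i => (x i : ℂ)) P
    ∂(Measure.pi fun _ : σ => gaussianReal 0 1)

open MvPolynomial in
/-- A linear functional killing `1` and satisfying the Gaussian integration by parts rule
vanishes identically. -/
lemma MvPolynomial.linearMap_eq_zero_of_pderiv {σ R M : Type*} [CommRing R] [AddCommGroup M]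
    [Module R M] (D : MvPolynomial σ R →ₗ[R] M) (h1 : D 1 = 0)
    (hX : ∀ i F, D (X i * F) = D (pderiv i F)) : D = 0 := by
  classical
  have key (k : ℕ) : ∀ s : σ →₀ ℕ, s.degree = k → ∀ a, D (monomial s a) = 0 := by
    induction k using Nat.strong_induction_on with
    | _ k ih =>
      intro s hs a
      by_cases h0 : s = 0
      · rw [h0, ← mul_one a, ← smul_eq_mul, ← smul_monomial, map_smul]
        exact (congrArg (a • ·) h1).trans (smul_zero a)
      · obtain ⟨i, hi⟩ := Finsupp.ne_iff.mp h0
        have hle : Finsupp.single i 1 ≤ s := by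
          rw [Finsupp.single_le_iff]
          exact Nat.one_le_iff_ne_zero.mpr hi
        obtain ⟨u, rfl⟩ := exists_add_of_le hle
        have hmul : monomial (Finsupp.single i 1 + u) a = X i * monomial u a := by
          simp [X, monomial_mul]
        rw [hmul, hX, pderiv_monomial]
        refine ih _ ?_ _ rfl _
        have hdeg : (u - Finsupp.single i 1).degree ≤ u.degree :=
          Finsupp.degree_mono tsub_le_self
        simp only [map_add, Finsupp.degree_single] at hs
        omega
  exact (basisMonomials σ R).ext fun s => by simpa using key _ s rfl 1

/-- The `k`-th moment of the standard Gaussian distribution on `ℝ`. -/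
noncomputable def gaussMoment (k : ℕ) : ℝ := ∫ x, x ^ k ∂(gaussianReal 0 1)

lemma integrable_pow_gaussianReal (k : ℕ) :
    Integrable (fun x : ℝ => x ^ k) (gaussianReal 0 1) :=
  integrable_pow_of_mem_interior_integrableExpSet (X := id) (by simp) k

lemma integrable_gaussianPDFReal_mul {f : ℝ → ℝ} (hf : Integrable f (gaussianReal 0 1)) :
    Integrable (fun x => gaussianPDFReal 0 1 x * f x) := by
  rw [gaussianReal_of_var_ne_zero _ one_ne_zero, integrable_withDensity_iff_integrable_smul'
    (measurable_gaussianPDF _ _) (ae_of_all _ fun _ => gaussianPDF_lt_top)] at hf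
  simpa using hf

lemma hasDerivAt_gaussianPDFReal (x : ℝ) :
    HasDerivAt (gaussianPDFReal 0 1) (-x * gaussianPDFReal 0 1 x) x := by
  have h : HasDerivAt (fun y : ℝ => -(y - 0) ^ 2 / (2 * ((1 : NNReal) : ℝ))) (-x) x := by
    refine ((((hasDerivAt_id x).sub_const 0).pow 2).neg.div_const
      (2 * ((1 : NNReal) : ℝ))).congr_deriv ?_
    simp
    ring
  refine (h.exp.const_mul (√(2 * Real.pi * (1 : NNReal)))⁻¹).congr_deriv ?_
  rw [gaussianPDFReal_def]
  ring

@[simp]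
lemma gaussMoment_zero : gaussMoment 0 = 1 := by simp [gaussMoment]

lemma gaussMoment_succ (k : ℕ) : gaussMoment (k + 1) = k * gaussMoment (k - 1) := by
  have hintegrable : Integrable (fun x : ℝ => k * x ^ (k - 1) - x ^ (k + 1)) (gaussianReal 0 1) :=
    ((integrable_pow_gaussianReal _).const_mul _).sub (integrable_pow_gaussianReal _)
  have h := integral_eq_zero_of_hasDerivAt_of_integrable
    (f := fun x => gaussianPDFReal 0 1 x * x ^ k)
    (f' := fun x => gaussianPDFReal 0 1 x * (k * x ^ (k - 1) - x ^ (k + 1)))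
    (fun x => ((hasDerivAt_gaussianPDFReal x).mul (hasDerivAt_pow k x)).congr_deriv (by ring))
    (integrable_gaussianPDFReal_mul hintegrable)
    (integrable_gaussianPDFReal_mul (integrable_pow_gaussianReal k))
  have h' := integral_gaussianReal_eq_integral_smul (μ := 0) (v := 1) one_ne_zero
    (f := fun x : ℝ => k * x ^ (k - 1) - x ^ (k + 1))
  simp only [smul_eq_mul] at h'
  rw [h, integral_sub ((integrable_pow_gaussianReal _).const_mul _)
    (integrable_pow_gaussianReal _), integral_const_mul] at h'
  unfold gaussMoment
  linarith

section FormalGaussian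

variable {σ : Type*} [Fintype σ]

open MvPolynomial

/-- The Gaussian expectation of polynomials with coefficients in a commutative `ℂ`-algebra,
defined through the moments of the monomials. -/
noncomputable def formalGaussExp (R : Type*) [CommRing R] [Algebra ℂ R] :
    MvPolynomial σ R →ₗ[R] R :=
  (basisMonomials σ R).constr R fun s => algebraMap ℂ R (∏ i, (gaussMoment (s i) : ℂ))

variable {R : Type*} [CommRing R] [Algebra ℂ R]

lemma formalGaussExp_monomial (s : σ →₀ ℕ) (a : R) :
    formalGaussExp R (monomial s a) = a * algebraMap ℂ R (∏ i, (gaussMoment (s i) : ℂ)) := by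
  have h : monomial s a = a • basisMonomials σ R s := by simp [smul_monomial]
  rw [h, map_smul, formalGaussExp, Module.Basis.constr_basis, smul_eq_mul]

lemma formalGaussExp_C (a : R) : formalGaussExp R (C a : MvPolynomial σ R) = a := by
  rw [C_apply, formalGaussExp_monomial]
  simp

lemma formalGaussExp_X_mul (i : σ) (F : MvPolynomial σ R) :
    formalGaussExp R (X i * F) = formalGaussExp R (pderiv i F) := by
  classical
  induction F using MvPolynomial.induction_on' with
  | add p q hp hq => simp only [mul_add, map_add, hp, hq]
  | monomial s a =>
    have hmul : X i * monomial s a = monomial (Finsupp.single i 1 + s) a := by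
      simp [X, monomial_mul]
    have hprod : ∏ j, (gaussMoment ((Finsupp.single i 1 + s : σ →₀ ℕ) j) : ℂ) =
        s i * ∏ j, (gaussMoment ((s - Finsupp.single i 1 : σ →₀ ℕ) j) : ℂ) := by
      rw [← Finset.mul_prod_erase _ _ (Finset.mem_univ i),
        ← Finset.mul_prod_erase _ _ (Finset.mem_univ i), ← mul_assoc]
      congr 1
      · simp [add_comm 1, gaussMoment_succ]
      · refine Finset.prod_congr rfl fun j hj => ?_
        simp [Finsupp.single_eq_of_ne (Finset.ne_of_mem_erase hj)]
    rw [hmul, pderiv_monomial, formalGaussExp_monomial, formalGaussExp_monomial, hprod, map_mul,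
      map_natCast, mul_assoc]

lemma formalGaussExp_map {S : Type*} [CommRing S] [Algebra ℂ S] (f : R →+* S)
    (hf : ∀ c, f (algebraMap ℂ R c) = algebraMap ℂ S c) (F : MvPolynomial σ R) :
    formalGaussExp S (map f F) = f (formalGaussExp R F) := by
  induction F using MvPolynomial.induction_on' with
  | add p q hp hq => simp only [map_add, hp, hq]
  | monomial s a =>
    rw [map_monomial, formalGaussExp_monomial, formalGaussExp_monomial, map_mul, hf]

lemma gaussExp_eq_formalGaussExp (P : MvPolynomial σ ℂ) : gaussExp P = formalGaussExp ℂ P := by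
  have hprod (s : σ →₀ ℕ) (a : ℂ) (x : σ → ℝ) :
      eval (fun i => (x i : ℂ)) (monomial s a) = a * ∏ i, ((x i ^ s i : ℝ) : ℂ) := by
    rw [eval_monomial, Finsupp.prod_fintype _ _ (by simp)]
    simp
  have hintegrable (F : MvPolynomial σ ℂ) : Integrable (fun x : σ → ℝ => eval (fun i => (x i : ℂ)) F)
      (Measure.pi fun _ : σ => gaussianReal 0 1) := by
    induction F using MvPolynomial.induction_on' with
    | add p q hp hq =>
      simp only [map_add]
      exact hp.add hq
    | monomial s a =>
      simp only [hprod]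
      exact (Integrable.fintype_prod fun i =>
        (integrable_pow_gaussianReal (s i)).ofReal (𝕜 := ℂ)).const_mul a
  induction P using MvPolynomial.induction_on' with
  | add p q hp hq =>
    rw [map_add, ← hp, ← hq]
    unfold gaussExp
    simp only [map_add]
    exact integral_add (hintegrable p) (hintegrable q)
  | monomial s a =>
    rw [formalGaussExp_monomial]
    unfold gaussExp gaussMoment
    simp only [hprod]
    rw [integral_const_mul,
      integral_fintype_prod_eq_prod (fun i (y : ℝ) => ((y ^ s i : ℝ) : ℂ))]
    simp only [integral_complex_ofReal, Algebra.algebraMap_self, RingHom.id_apply]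

/-- The linear substitution `xᵢ ↦ ∑ⱼ Λᵢⱼ xⱼ`. -/
noncomputable abbrev linearSubst (Λ : Matrix σ σ R) : MvPolynomial σ ℂ →ₐ[ℂ] MvPolynomial σ R :=
  aeval fun i => ∑ j, C (Λ i j) * X j

lemma pderiv_linearSubst (Λ : Matrix σ σ R) (j : σ) (F : MvPolynomial σ ℂ) :
    pderiv j (linearSubst Λ F) = ∑ k, C (Λ k j) * linearSubst Λ (pderiv k F) := by
  classical
  induction F using MvPolynomial.induction_on with
  | C a =>
    have h : linearSubst Λ (C a) = C (algebraMap ℂ R a) := by simp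
    rw [h]
    simp
  | add p q hp hq => simp only [map_add, hp, hq, mul_add, Finset.sum_add_distrib]
  | mul_X p i hp =>
    have hX : pderiv j (∑ l, C (Λ i l) * X l) = C (Λ i j) := by
      simp [Derivation.leibniz, pderiv_X, Pi.single_apply]
    have hpd (k : σ) : linearSubst Λ (pderiv k (p * X i)) =
        linearSubst Λ p * (if i = k then 1 else 0) +
          (∑ l, C (Λ i l) * X l) * linearSubst Λ (pderiv k p) := by
      rw [Derivation.leibniz, pderiv_X, Pi.single_apply, map_add, smul_eq_mul, smul_eq_mul,
        map_mul, map_mul, aeval_X]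
      split_ifs <;> simp
    simp only [hpd]
    rw [map_mul, aeval_X, Derivation.leibniz, hp, hX, smul_eq_mul, smul_eq_mul]
    generalize ∑ l, C (Λ i l) * X l = L
    simp only [mul_add, Finset.sum_add_distrib, mul_left_comm _ L, ← Finset.mul_sum]
    simp [mul_comm]

/-- The formal Gaussian expectation is invariant under formal orthogonal substitutions. -/
lemma formalGaussExp_linearSubst [DecidableEq σ] (Λ : Matrix σ σ R) (hΛ : Λ.transpose * Λ = 1)
    (F : MvPolynomial σ ℂ) :
    formalGaussExp R (linearSubst Λ F) = algebraMap ℂ R (formalGaussExp ℂ F) := by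
  have hΛ' : Λ * Λ.transpose = 1 := mul_eq_one_comm.mp hΛ
  let D : MvPolynomial σ ℂ →ₗ[ℂ] R :=
    ((formalGaussExp R).restrictScalars ℂ).comp (linearSubst Λ).toLinearMap -
      (Algebra.linearMap ℂ R).comp (formalGaussExp ℂ)
  have hD (F) : D F = formalGaussExp R (linearSubst Λ F) -
      algebraMap ℂ R (formalGaussExp ℂ F) := rfl
  have h0 : D = 0 := by
    refine linearMap_eq_zero_of_pderiv D ?_ fun i F => ?_
    · rw [hD, map_one, ← C_1, ← C_1, formalGaussExp_C, formalGaussExp_C, map_one, sub_self]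
    · rw [hD, hD, formalGaussExp_X_mul]
      congr 1
      have hC (a : R) (G : MvPolynomial σ R) :
          formalGaussExp R (C a * G) = a * formalGaussExp R G := by
        rw [C_mul', map_smul, smul_eq_mul]
      simp only [map_mul, aeval_X, Finset.sum_mul, map_sum, mul_assoc, hC, formalGaussExp_X_mul,
        pderiv_linearSubst, Finset.mul_sum]
      rw [Finset.sum_comm]
      simp only [← mul_assoc, ← Finset.sum_mul]
      have horth (k : σ) : ∑ j, Λ i j * Λ k j = if i = k then 1 else 0 := by
        simpa [Matrix.mul_apply, Matrix.one_apply] using congrFun (congrFun hΛ' i) k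
      simp [horth]
  exact sub_eq_zero.mp (by rw [← hD, h0, LinearMap.zero_apply])

end FormalGaussian

section Laurent

open MvPolynomial

/-- Denominators in `t` of a polynomial with Laurent polynomial coefficients can be cleared. -/
lemma MvPolynomial.exists_C_T_mul_eq_map_toLaurent {σ A : Type*} [CommRing A]
    (F : MvPolynomial σ (LaurentPolynomial A)) :
    ∃ (N : ℕ) (G : MvPolynomial σ (Polynomial A)),
      C (LaurentPolynomial.T N) * F = map Polynomial.toLaurent G := by
  induction F using MvPolynomial.induction_on with
  | C a =>
    obtain ⟨N, f, hf⟩ := a.exists_T_pow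
    exact ⟨N, C f, by rw [map_C, hf, ← C_mul, mul_comm]⟩
  | add p q hp hq =>
    obtain ⟨M, f, hf⟩ := hp
    obtain ⟨N, g, hg⟩ := hq
    refine ⟨M + N, C (Polynomial.X ^ N) * f + C (Polynomial.X ^ M) * g, ?_⟩
    simp only [map_add, map_mul, map_C, Polynomial.toLaurent_X_pow, ← hf, ← hg, Nat.cast_add,
      LaurentPolynomial.T_add]
    ring
  | mul_X p i hp =>
    obtain ⟨N, f, hf⟩ := hp
    exact ⟨N, f * X i, by rw [map_mul, map_X, ← hf, mul_assoc]⟩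

lemma MvPolynomial.exists_eq_C_T_mul_map_toLaurent {σ A : Type*} [CommRing A]
    (F : MvPolynomial σ (LaurentPolynomial A))
    (hF : ∀ s, ∃ q : Polynomial A, coeff s F = Polynomial.toLaurent (Polynomial.X * q)) :
    ∃ G : MvPolynomial σ (Polynomial A),
      F = C (LaurentPolynomial.T 1) * map Polynomial.toLaurent G := by
  choose q hq using hF
  refine ⟨∑ s ∈ F.support, monomial s (q s), ?_⟩
  conv_lhs => rw [F.as_sum]
  simp only [map_sum, map_monomial, Finset.mul_sum, C_mul_monomial]
  exact Finset.sum_congr rfl fun s _ => by rw [hq, map_mul, Polynomial.toLaurent_X]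

end Laurent

/-- let `Λ` be an `n×n` matrix over the Laurent polynomial ring
`ℂ[t,t⁻¹]` with `ΛᵀΛ = I`.  If every coefficient of the polynomial `P(Λx)`
(a polynomial in `x` with coefficients in `ℂ[t,t⁻¹]`) lies in `t·ℂ[t]`, then for
every `Q ∈ ℂ[x₁,…,xₙ]` one has `E(Q·P^m) = 0` for all sufficiently large `m`. -/
theorem gaussian_moments_vanish_of_one_parameter_subgroup (n : ℕ)
    (P : MvPolynomial (Fin n) ℂ) (Λ : Matrix (Fin n) (Fin n) (LaurentPolynomial ℂ))
    (hΛ : Λ.transpose * Λ = 1)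
    (hpos : ∀ α : Fin n →₀ ℕ,
      ∃ q : Polynomial ℂ,
        MvPolynomial.coeff α
          (MvPolynomial.aeval
            (fun i => ∑ j : Fin n, MvPolynomial.C (Λ i j) * MvPolynomial.X j) P) =
        Polynomial.toLaurent (Polynomial.X * q)) :
    ∀ Q : MvPolynomial (Fin n) ℂ, ∃ N : ℕ, ∀ m : ℕ, N ≤ m →
      gaussExp (Q * P ^ m) = 0 := by
  intro Q
  obtain ⟨N, Q', hQ⟩ := MvPolynomial.exists_C_T_mul_eq_map_toLaurent (linearSubst Λ Q)
  obtain ⟨P', hP⟩ := MvPolynomial.exists_eq_C_T_mul_map_toLaurent (linearSubst Λ P) hpos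
  refine ⟨N + 1, fun m hm => ?_⟩
  rw [gaussExp_eq_formalGaussExp]
  set c := formalGaussExp ℂ (Q * P ^ m) with hc
  have hsubst : MvPolynomial.C (LaurentPolynomial.T N) * linearSubst Λ (Q * P ^ m) =
      MvPolynomial.C (LaurentPolynomial.T m) *
        MvPolynomial.map Polynomial.toLaurent (Q' * P' ^ m) := by
    have hT : (LaurentPolynomial.T m : LaurentPolynomial ℂ) = LaurentPolynomial.T 1 ^ m := by
      rw [LaurentPolynomial.T_pow, mul_one]
    calc _ = MvPolynomial.C (LaurentPolynomial.T N) * linearSubst Λ Q * linearSubst Λ P ^ m := by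
          rw [map_mul (linearSubst Λ), map_pow (linearSubst Λ), mul_assoc]
      _ = _ := by
          rw [hQ, hP, mul_pow, mul_left_comm, hT, MvPolynomial.C_pow,
            map_mul (MvPolynomial.map _), map_pow (MvPolynomial.map _)]
  have hf (c : ℂ) : Polynomial.toLaurent (algebraMap ℂ (Polynomial ℂ) c) =
      algebraMap ℂ (LaurentPolynomial ℂ) c := (Polynomial.toLaurentAlg (R := ℂ)).commutes c
  have hexp := congrArg (formalGaussExp (LaurentPolynomial ℂ)) hsubst
  rw [MvPolynomial.C_mul', MvPolynomial.C_mul', map_smul, map_smul, smul_eq_mul, smul_eq_mul,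
    formalGaussExp_linearSubst Λ hΛ, formalGaussExp_map _ hf, ← hc,
    ← Polynomial.toLaurent_X_pow, ← Polynomial.toLaurent_X_pow,
    LaurentPolynomial.algebraMap_apply, Algebra.algebraMap_self, RingHom.id_apply,
    ← Polynomial.toLaurent_C, ← map_mul, ← map_mul] at hexp
  have hcoeff := congrArg (Polynomial.coeff · N) (Polynomial.toLaurent_injective hexp)
  simpa [Polynomial.coeff_X_pow_mul', show ¬ m ≤ N by omega] using hcoeff
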